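/- arXiv:2411.02667 — 7 statements merged into one kernel-verified Lean document; each statement's English description precedes it below -/
import Mathlib

section
/- A stable configuration c = (c_1, c_2, ..., c_{n+1}) on the complete bipartite graph K_{2,n} with sink v_0 (so 0 ≤ c_1 < n and c_j ∈ {0,1} for all 2 ≤ j ≤ n+1) is stochastically recurrent if and only if c_1 ≥ |{j ∈ {2, ..., n+1} : c_j = 0}|. That is, Sto(K_{2,n}) = {(c_1, c_2, ..., c_{n+1}) : c_2, ..., c_{n+1} ∈ {0,1} and c_1 ≥ |{j ∈ {2,...,n+1} : c_j = 0}|}. -/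
/-!
STATEMENT 1. We model the complete bipartite graph `K_{2,n}` with vertex set
`{v_0, v_1, ..., v_{n+1}}`: the left part `{v_0, v_1}` is represented by `Fin 2`
(with index `0` the sink `v_0` and index `1` the vertex `v_1`), and the right part
`{v_2, ..., v_{n+1}}` is represented by `Fin n`.  An orientation is a function
`O : Fin 2 → Fin n → Bool`, where `O i j = true` means the edge between left
vertex `i` and right vertex `v_{j+2}` is directed from `i` to `v_{j+2}`, and
`O i j = false` means it is directed from `v_{j+2}` to `i`.

A configuration assigns `c1` grains to `v_1` (degree `n`) and `c j` grains to the
right vertex `v_{j+2}` (degree `2`).  Stability: `c1 < n` and `c j < 2`.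
The configuration is compatible with `O` when `in_O(v) ≥ d(v) - c(v)` for every
non-sink vertex `v`; it is stochastically recurrent when it is compatible with at
least one orientation.  The theorem: a stable configuration is stochastically
recurrent iff `c1 ≥ |{j : c j = 0}|`.
-/

theorem sto_K2n_characterization
    (n : ℕ) (hn : 1 ≤ n) (c1 : ℕ) (c : Fin n → ℕ)
    (h1 : c1 < n) (hc : ∀ j, c j < 2) :
    (∃ O : Fin 2 → Fin n → Bool,
        n - c1 ≤ (Finset.univ.filter fun j : Fin n => O 1 j = false).card ∧
        ∀ j : Fin n, 2 - c j ≤ (Finset.univ.filter fun i : Fin 2 => O i j = true).card) ↔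
    (Finset.univ.filter fun j : Fin n => c j = 0).card ≤ c1 := by
  have hsplit : (Finset.univ.filter fun j : Fin n => c j = 0).card +
      (Finset.univ.filter fun j : Fin n => ¬ c j = 0).card = n := by
    simpa using Finset.card_filter_add_card_filter_not (s := (Finset.univ : Finset (Fin n)))
      (fun j => c j = 0)
  constructor
  · rintro ⟨O, hO, hr⟩
    have hle : (Finset.univ.filter fun j : Fin n => O 1 j = false).card ≤
        (Finset.univ.filter fun j : Fin n => ¬ c j = 0).card := by
      refine Finset.card_le_card fun j hj => ?_
      simp only [Finset.mem_filter, Finset.mem_univ, true_and] at hj ⊢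
      intro h0
      have hin := hr j
      rw [h0, Finset.card_filter, Fin.sum_univ_two, hj] at hin
      simp only [Bool.false_eq_true, if_false] at hin
      split_ifs at hin <;> omega
    omega
  · intro h
    refine ⟨fun i j => decide (i = 0 ∨ c j = 0), ?_, fun j => ?_⟩
    · simp only [decide_eq_false_iff_not, one_ne_zero, false_or]
      omega
    · rw [Finset.card_filter, Fin.sum_univ_two]
      by_cases h0 : c j = 0 <;> simp [h0]
      omega
end

section
/- For n ≥ 1, the lacking polynomial of the complete bipartite graph K_{2,n} with sink v_0 is L_{2,n}(x) = Σ_{k=0}^{n-1} (Σ_{i=0}^{k} C(n,i)) x^k, where C(n,i) denotes the binomial coefficient. -/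
/-!
STATEMENT 2. We model the complete bipartite graph `K_{2,n}` with vertex set
`{v_0, v_1, ..., v_{n+1}}`: the left part `{v_0, v_1}` is represented by `Fin 2`
(index `0` is the sink `v_0`), and the right part `{v_2, ..., v_{n+1}}` by `Fin n`.
An orientation is `O : Fin 2 → Fin n → Bool` (`O i j = true` means the edge is
directed from left vertex `i` to right vertex `v_{j+2}`).

A stable configuration is a pair `p = (p.1, p.2)` with `p.1 : Fin n` the number of
grains on `v_1` (degree `n`) and `p.2 j : Fin 2` the number of grains on `v_{j+2}`
(degree `2`); the types enforce stability.  `p` is compatible with `O` when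
`in_O(v) ≥ d(v) - c(v)` for each non-sink vertex `v`, and is stochastically
recurrent when compatible with some orientation.  The level of `p` is the sum of
the lacking numbers `d(v) - c(v) - 1` over non-sink vertices, namely
`(n - 1 - p.1) + ∑ j, (1 - p.2 j)`, and the lacking polynomial is
`L_{2,n}(x) = ∑_{p recurrent} x^{level p}`.

The theorem: `L_{2,n}(x) = ∑_{k=0}^{n-1} (∑_{i=0}^{k} C(n,i)) x^k`.
-/

open Finset in
theorem sum_one_sub_eq_card_zeros {n : ℕ} (c : Fin n → Fin 2) :
    ∑ j, (1 - (c j : ℕ)) = #{j | c j = 0} := by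
  rw [card_filter]
  refine sum_congr rfl fun j _ => ?_
  generalize c j = a
  revert a
  decide

open Finset in
theorem exists_compatible_orientation_iff {n : ℕ} (a : ℕ) (ha : a ≤ n) (c : Fin n → Fin 2) :
    (∃ O : Fin 2 → Fin n → Bool,
      n - a ≤ #{j | O 1 j = false} ∧ ∀ j, 2 - (c j : ℕ) ≤ #{i | O i j = true}) ↔
      #{j | c j = 0} ≤ a := by
  have hcard : #{j | c j = 0} + #{j | ¬ c j = 0} = n := by
    simpa using card_filter_add_card_filter_not (s := univ) (fun j => c j = 0)
  constructor
  · rintro ⟨O, h1, h2⟩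
    have hsub : #{j | O 1 j = false} ≤ #{j | ¬ c j = 0} := by
      refine card_le_card (monotone_filter_right _ fun j _ hj hc => ?_)
      have h := h2 j
      rw [card_filter, Fin.sum_univ_two, hc, hj] at h
      revert h
      cases O 0 j <;> decide
    omega
  · intro h
    refine ⟨fun i j => i = 0 || c j = 0, ?_, fun j => ?_⟩
    · have heq : #{j | ((1 : Fin 2) = 0 || c j = 0 : Bool) = false} = #{j | ¬ c j = 0} := by
        congr 1
        ext j
        simp
      rw [heq]
      omega
    · change 2 - (c j : ℕ) ≤ #{i : Fin 2 | (i = 0 || c j = 0 : Bool) = true}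
      generalize c j = b
      revert b
      decide

open Finset in
theorem sum_card_zeros {M : Type*} [AddCommMonoid M] (n : ℕ) (f : ℕ → M) :
    ∑ c : Fin n → Fin 2, f #{j | c j = 0} = ∑ i ∈ range (n + 1), n.choose i • f i := by
  have h := sum_powerset_apply_card f (x := (univ : Finset (Fin n)))
  rw [card_univ, Fintype.card_fin] at h
  rw [← h]
  refine sum_nbij' (fun c => ({j | c j = 0} : Finset (Fin n))) (fun S j => if j ∈ S then 0 else 1)
    (by simp) (by simp) (fun c _ => ?_) (fun S _ => ?_) (by simp)
  · funext j
    simp only [mem_filter, mem_univ, true_and]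
    generalize c j = b
    revert b
    decide
  · ext j
    simp

open Finset in
theorem sum_pow_reflect {R : Type*} [Semiring R] (n s : ℕ) (x : R) :
    ∑ a : Fin n, (if s ≤ a then x ^ (n - 1 - (a : ℕ) + s) else 0) =
      ∑ k ∈ range n, if s ≤ k then x ^ k else 0 := by
  rw [Fin.sum_univ_eq_sum_range (fun a => if s ≤ a then x ^ (n - 1 - a + s) else 0),
    ← sum_filter, ← sum_filter]
  refine sum_nbij' (fun a => n - 1 - a + s) (fun k => n - 1 - k + s) ?_ ?_ ?_ ?_ ?_
  all_goals intro a h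
  all_goals simp only [mem_filter, mem_range] at h ⊢
  all_goals omega

theorem lacking_polynomial_K2n (n : ℕ) (hn : 1 ≤ n) :
    ∑ p ∈ (Finset.univ : Finset (Fin n × (Fin n → Fin 2))).filter
        (fun p => ∃ O : Fin 2 → Fin n → Bool,
          n - (p.1 : ℕ) ≤ (Finset.univ.filter fun j : Fin n => O 1 j = false).card ∧
          ∀ j : Fin n,
            2 - (p.2 j : ℕ) ≤ (Finset.univ.filter fun i : Fin 2 => O i j = true).card),
      (Polynomial.X : Polynomial ℤ) ^ ((n - 1 - (p.1 : ℕ)) + ∑ j : Fin n, (1 - (p.2 j : ℕ)))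
    = ∑ k ∈ Finset.range n,
        Polynomial.C (∑ i ∈ Finset.range (k + 1), (n.choose i : ℤ)) * Polynomial.X ^ k := by
  rw [Finset.sum_filter]
  refine (Finset.sum_congr rfl fun p _ =>
    if_congr (exists_compatible_orientation_iff (p.1 : ℕ) p.1.is_lt.le p.2)
      (congrArg (fun s => (Polynomial.X : Polynomial ℤ) ^ (n - 1 - (p.1 : ℕ) + s))
        (sum_one_sub_eq_card_zeros p.2)) rfl).trans ?_
  rw [Fintype.sum_prod_type_right]
  simp only [sum_pow_reflect]
  rw [sum_card_zeros n fun s => ∑ k ∈ Finset.range n,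
    if s ≤ k then (Polynomial.X : Polynomial ℤ) ^ k else 0]
  simp only [Finset.smul_sum]
  rw [Finset.sum_comm]
  refine Finset.sum_congr rfl fun k hk => ?_
  have hfilter : (Finset.range (n + 1)).filter (· ≤ k) = Finset.range (k + 1) := by
    ext i
    simp only [Finset.mem_filter, Finset.mem_range] at hk ⊢
    omega
  simp only [smul_ite, smul_zero]
  rw [← Finset.sum_filter, hfilter, map_sum, Finset.sum_mul]
  refine Finset.sum_congr rfl fun i _ => ?_
  simp [nsmul_eq_mul]
end

section
/- For n ≥ 1 and every integer k with 0 ≤ k ≤ n−1, the number of stochastically recurrent configurations c on the complete bipartite graph K_{2,n} (sink v_0) with level ℓ(c) = k equals Σ_{i=0}^{k} C(n,i); moreover no stochastically recurrent configuration on K_{2,n} has level ℓ(c) ≥ n. -/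
/-!
STATEMENT 3. Model of `K_{2,n}` as in the previous statements: left part `Fin 2`
(index `0` is the sink `v_0`, index `1` is `v_1`, of degree `n`), right part
`Fin n` (vertices `v_2, ..., v_{n+1}`, each of degree `2`).  An orientation is
`O : Fin 2 → Fin n → Bool` (`true` = directed from left to right).  A stable
configuration is `p : Fin n × (Fin n → Fin 2)` (`p.1` = grains on `v_1`,
`p.2 j` = grains on `v_{j+2}`; the types enforce stability).  `p` is
stochastically recurrent iff compatible with some orientation, i.e.
`in_O(v) ≥ d(v) - c(v)` for all non-sink `v`.  The level of `p` is
`ℓ(p) = (n - 1 - p.1) + ∑ j, (1 - p.2 j)`.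

The theorem: for `0 ≤ k ≤ n-1` the number of stochastically recurrent
configurations of level `k` is `∑_{i=0}^{k} C(n,i)`, and no stochastically
recurrent configuration has level `≥ n`.
-/

open Finset in
/-- A configuration on `K_{2,n}` is compatible with some orientation iff the number of empty
vertices in the right part is at most the number of grains on `v_1`. -/
theorem exists_orientation_iff {n : ℕ} (p : Fin n × (Fin n → Fin 2)) :
    (∃ O : Fin 2 → Fin n → Bool,
      n - (p.1 : ℕ) ≤ #{j : Fin n | O 1 j = false} ∧
      ∀ j : Fin n, 2 - (p.2 j : ℕ) ≤ #{i : Fin 2 | O i j = true}) ↔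
    #{j : Fin n | p.2 j = 0} ≤ (p.1 : ℕ) := by
  have hc (q : Fin n → Prop) [DecidablePred q] : #{j | q j} + #{j | ¬ q j} = n := by
    simpa using card_filter_add_card_filter_not (s := (univ : Finset (Fin n))) q
  constructor
  · rintro ⟨O, hO, hR⟩
    have hsub : #{j : Fin n | p.2 j = 0} ≤ #{j : Fin n | ¬ O 1 j = false} := by
      refine card_le_card fun j hj => ?_
      simp only [mem_filter, mem_univ, true_and] at hj ⊢
      intro hfalse
      have h2 := hR j
      have h1 : #{i : Fin 2 | O i j = true} ≤ #({0} : Finset (Fin 2)) := by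
        refine card_le_card fun i hi => ?_
        simp only [mem_filter, mem_univ, true_and] at hi
        fin_cases i <;> simp_all
      simp only [hj, card_singleton, Fin.val_zero] at h1 h2
      omega
    have := hc fun j => O 1 j = false
    omega
  · intro h
    refine ⟨fun i j => decide (i = 0 ∨ p.2 j = 0), ?_, fun j => ?_⟩
    · have := hc fun j => p.2 j = 0
      simp only [one_ne_zero, false_or, decide_eq_false_iff_not]
      omega
    · by_cases hj : p.2 j = 0
      · simp [hj]
      · have hpos : 0 < #{i : Fin 2 | decide (i = 0 ∨ p.2 j = 0) = true} :=
          card_pos.2 ⟨0, by simp⟩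
        have : (p.2 j : ℕ) ≠ 0 := fun h0 => hj (Fin.ext h0)
        beta_reduce
        omega

open Finset in
theorem sum_one_sub_eq_card_filter {n : ℕ} (f : Fin n → Fin 2) :
    ∑ j, (1 - (f j : ℕ)) = #{j | f j = 0} := by
  rw [card_filter]
  refine sum_congr rfl fun j _ => ?_
  generalize f j = x
  fin_cases x <;> rfl

open Finset in
theorem card_filter_card_le {α : Type*} [Fintype α] (k : ℕ) :
    #{s : Finset α | #s ≤ k} = ∑ i ∈ range (k + 1), (Fintype.card α).choose i := by
  classical
  rw [card_eq_sum_card_fiberwise (f := card) (t := range (k + 1))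
    (fun s hs => by simpa [Nat.lt_succ_iff] using hs)]
  refine sum_congr rfl fun i hi => ?_
  rw [← card_univ, ← card_powersetCard]
  congr 1
  ext s
  simp only [mem_range] at hi
  simp only [mem_filter, mem_univ, true_and, mem_powersetCard, subset_univ]
  omega

theorem sto_K2n_level_count (n : ℕ) (hn : 1 ≤ n) :
    (∀ k : ℕ, k < n →
      ((Finset.univ : Finset (Fin n × (Fin n → Fin 2))).filter
        (fun p => (∃ O : Fin 2 → Fin n → Bool,
          n - (p.1 : ℕ) ≤ (Finset.univ.filter fun j : Fin n => O 1 j = false).card ∧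
          ∀ j : Fin n,
            2 - (p.2 j : ℕ) ≤ (Finset.univ.filter fun i : Fin 2 => O i j = true).card) ∧
          (n - 1 - (p.1 : ℕ)) + ∑ j : Fin n, (1 - (p.2 j : ℕ)) = k)).card
        = ∑ i ∈ Finset.range (k + 1), n.choose i) ∧
    (∀ p : Fin n × (Fin n → Fin 2),
      (∃ O : Fin 2 → Fin n → Bool,
          n - (p.1 : ℕ) ≤ (Finset.univ.filter fun j : Fin n => O 1 j = false).card ∧
          ∀ j : Fin n,
            2 - (p.2 j : ℕ) ≤ (Finset.univ.filter fun i : Fin 2 => O i j = true).card) →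
      (n - 1 - (p.1 : ℕ)) + ∑ j : Fin n, (1 - (p.2 j : ℕ)) < n) := by
  simp only [exists_orientation_iff, sum_one_sub_eq_card_filter]
  refine ⟨fun k hk => ?_, fun p hp => by have := p.1.isLt; omega⟩
  have key := card_filter_card_le (α := Fin n) k
  rw [Fintype.card_fin] at key
  rw [← key]
  refine Finset.card_bij' (fun p _ => Finset.univ.filter fun j => p.2 j = 0)
    (fun s _ => (⟨n - 1 - (k - s.card), by omega⟩, fun j => if j ∈ s then 0 else 1))
    ?_ ?_ ?_ ?_
  · intro p hp
    simp only [Finset.mem_filter, Finset.mem_univ, true_and] at hp ⊢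
    omega
  · intro s hs
    simp only [Finset.mem_filter, Finset.mem_univ, true_and] at hs
    simp only [Finset.mem_filter, Finset.mem_univ, true_and, ite_eq_left_iff, one_ne_zero,
      imp_false, not_not, Finset.filter_univ_mem]
    omega
  · intro p hp
    simp only [Finset.mem_filter, Finset.mem_univ, true_and] at hp
    refine Prod.ext (Fin.ext ?_) (funext fun j => ?_)
    · have := p.1.isLt
      dsimp only
      omega
    · simp only [Finset.mem_filter, Finset.mem_univ, true_and]
      split_ifs <;> omega
  · intro s _
    ext j
    simp
end

section
/- A stable configuration c = (c_1, ..., c_{m+1}) on the complete bipartite graph K_{m,2} with sink v_0 (so c_i ∈ {0,1} for all 1 ≤ i ≤ m−1 and 0 ≤ c_m, c_{m+1} < m) is stochastically recurrent if and only if c_m + c_{m+1} ≥ m − 1 + |X|, where X = {i ∈ {1, ..., m−1} : c_i = 0}. That is, Sto(K_{m,2}) = {(c_1, ..., c_{m+1}) : c_1, ..., c_{m-1} ∈ {0,1} and c_m + c_{m+1} ≥ m − 1 + |{i ∈ {1,...,m-1} : c_i = 0}|}. -/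
/-!
STATEMENT 5. We model the complete bipartite graph `K_{m,2}` with vertex set
`{v_0, v_1, ..., v_{m+1}}`: the left part `{v_0, ..., v_{m-1}}` is represented by
`Fin m` (index `0` is the sink `v_0`; the non-sink left vertex `v_{i+1}` is indexed
by `i : Fin (m-1)`), and the right part `{v_m, v_{m+1}}` by `Fin 2`.  An orientation
is `O : Fin m → Fin 2 → Bool`, where `O i j = true` means the edge between left
vertex `i` and right vertex `v_{m+j}` is directed from `i` to `v_{m+j}`.

A configuration assigns `c i` grains to `v_{i+1}` (degree `2`) for `i : Fin (m-1)`
and `b j` grains to `v_{m+j}` (degree `m`) for `j : Fin 2`.  Stability: `c i < 2`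
and `b j < m`.  The configuration is compatible with `O` when
`in_O(v) ≥ d(v) - c(v)` for every non-sink vertex `v`; it is stochastically
recurrent when compatible with at least one orientation.

The theorem: a stable configuration is stochastically recurrent iff
`b 0 + b 1 ≥ m - 1 + |X|`, where `X = {i : c i = 0}`.
-/

/-- The element of `Fin m` corresponding to the `i`-th non-sink left vertex `v_{i+1}`. -/
def leftIdx {m : ℕ} (i : Fin (m - 1)) : Fin m :=
  ⟨i.val + 1, by have := i.isLt; omega⟩

open Finset in
/-- Double counting of the edges between the non-sink left vertices and the right vertices:
any compatible orientation forces the total number of grains on the right to be large. -/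
theorem card_zero_le_of_compatible {n : ℕ} {c : Fin n → ℕ} {b : Fin 2 → ℕ}
    (hc : ∀ i, c i < 2) (hb : ∀ j, b j < n + 1) {O : Fin (n + 1) → Fin 2 → Bool}
    (hl : ∀ i : Fin n, 2 - c i ≤ #{j : Fin 2 | O i.succ j = false})
    (hr : ∀ j : Fin 2, n + 1 - b j ≤ #{i : Fin (n + 1) | O i j = true}) :
    n + #{i : Fin n | c i = 0} ≤ b 0 + b 1 := by
  have hin (j : Fin 2) : n + 1 - b j ≤ #{i : Fin n | O i.succ j = true} + 1 := by
    refine (hr j).trans ?_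
    rw [Fin.card_filter_univ_succ]
    split_ifs <;> omega
  have hcompl (j : Fin 2) :
      #{i : Fin n | O i.succ j = true} + #{i : Fin n | O i.succ j = false} = n := by
    simpa using card_filter_add_card_filter_not (s := univ) fun i : Fin n => O i.succ j = true
  have hsum : n + #{i : Fin n | c i = 0} ≤
      #{i : Fin n | O i.succ 0 = false} + #{i : Fin n | O i.succ 1 = false} := by
    calc n + #{i : Fin n | c i = 0} = ∑ i : Fin n, (1 + if c i = 0 then 1 else 0) := by
          rw [sum_add_distrib, card_filter]; simp
      _ ≤ ∑ i : Fin n, ((if O i.succ 0 = false then 1 else 0) +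
            if O i.succ 1 = false then 1 else 0) := by
          refine sum_le_sum fun i _ => ?_
          have h := hl i
          rw [card_filter, Fin.sum_univ_two] at h
          have := hc i
          split_ifs at h ⊢ <;> omega
      _ = _ := by rw [sum_add_distrib, card_filter, card_filter]
  have h0 := hin 0
  have h1 := hin 1
  have := hcompl 0
  have := hcompl 1
  have := hb 0
  have := hb 1
  omega

open Finset in
/-- If the right vertices hold enough grains, the left vertices holding a grain can be split
so as to supply both right vertices with the in-degrees they need. -/
theorem exists_compatible_of_card_zero_le {n : ℕ} {c : Fin n → ℕ} {b : Fin 2 → ℕ}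
    (hb : ∀ j, b j < n + 1) (h : n + #{i : Fin n | c i = 0} ≤ b 0 + b 1) :
    ∃ O : Fin (n + 1) → Fin 2 → Bool,
      (∀ i : Fin n, 2 - c i ≤ #{j : Fin 2 | O i.succ j = false}) ∧
      ∀ j : Fin 2, n + 1 - b j ≤ #{i : Fin (n + 1) | O i j = true} := by
  have hcompl : #{i : Fin n | c i = 0} + #{i : Fin n | ¬ c i = 0} = n := by
    simpa using card_filter_add_card_filter_not (s := univ) fun i : Fin n => c i = 0
  have hb0 := hb 0
  have hb1 := hb 1
  obtain ⟨T, hT, hTcard⟩ := exists_subset_card_eq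
    (show n - b 0 ≤ #{i : Fin n | ¬ c i = 0} by omega)
  have hdiff := card_sdiff_add_card_eq_card hT
  refine ⟨Fin.cons (fun _ => true) fun i =>
    ![decide (i ∈ T), decide (i ∈ ({i : Fin n | ¬ c i = 0} : Finset (Fin n)) \ T)], ?_, ?_⟩
  · intro i
    have hi : i ∈ T → c i ≠ 0 := fun hiT => by simpa using hT hiT
    rw [card_filter, Fin.sum_univ_two]
    by_cases hiT : i ∈ T
    · have := hi hiT
      simp [hiT]
      omega
    · by_cases hc0 : c i = 0
      · simp [hiT, hc0]
      · simp [hiT, hc0]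
        omega
  · rw [Fin.forall_fin_two]
    constructor <;> rw [Fin.card_filter_univ_succ] <;>
      simp only [Fin.cons_zero, Fin.cons_succ, Matrix.cons_val_zero,
        Matrix.cons_val_one, decide_eq_true_eq, if_true, filter_univ_mem] <;> omega

theorem sto_Km2_characterization
    (m : ℕ) (hm : 1 ≤ m) (c : Fin (m - 1) → ℕ) (b : Fin 2 → ℕ)
    (hc : ∀ i, c i < 2) (hb : ∀ j, b j < m) :
    (∃ O : Fin m → Fin 2 → Bool,
        (∀ i : Fin (m - 1),
          2 - c i ≤ (Finset.univ.filter fun j : Fin 2 => O (leftIdx i) j = false).card) ∧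
        (∀ j : Fin 2,
          m - b j ≤ (Finset.univ.filter fun i : Fin m => O i j = true).card)) ↔
    m - 1 + (Finset.univ.filter fun i : Fin (m - 1) => c i = 0).card ≤ b 0 + b 1 := by
  obtain ⟨n, rfl⟩ := Nat.exists_eq_add_of_le' hm
  exact ⟨fun ⟨_, hl, hr⟩ => card_zero_le_of_compatible (n := n) hc hb hl hr,
    fun h => exists_compatible_of_card_zero_le (n := n) hb h⟩
end

section
/- For m ≥ 1 and every integer k with 0 ≤ k ≤ m−1, the number of stochastically recurrent configurations c on the complete bipartite graph K_{m,2} (sink v_0) with level ℓ(c) = k equals Σ_{j=0}^{k} C(m−1,j)·(k − j + 1); moreover no stochastically recurrent configuration on K_{m,2} has level ℓ(c) ≥ m. -/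
open Finset in
/-- The orientation condition on `K_{n+1,2}` amounts to the level being at most `n`. -/
theorem exists_orientation_iff_level_le (n : ℕ) (c : Fin n → Fin 2) (x y : Fin (n + 1)) :
    (∃ O : Fin (n + 1) → Fin 2 → Bool,
      (∀ i : Fin n, 2 - (c i : ℕ) ≤ #{j : Fin 2 | O i.succ j = false}) ∧
      n + 1 - (x : ℕ) ≤ #{i : Fin (n + 1) | O i 0 = true} ∧
      n + 1 - (y : ℕ) ≤ #{i : Fin (n + 1) | O i 1 = true}) ↔
    (∑ i, (1 - (c i : ℕ))) + (n - (x : ℕ)) + (n - (y : ℕ)) < n + 1 := by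
  have hx := x.isLt
  have hy := y.isLt
  have hsum : ∑ i, (1 - (c i : ℕ)) + ∑ i, (c i : ℕ) = n := by
    rw [← sum_add_distrib]
    have h : ∀ i, 1 - (c i : ℕ) + (c i : ℕ) = 1 := fun i => by have := (c i).isLt; omega
    simp [h]
  constructor
  · rintro ⟨O, hO, h0, h1⟩
    rw [card_filter, Fin.sum_univ_succ] at h0 h1
    have hle : (∑ i : Fin n, if O i.succ 0 = true then 1 else 0) +
        (∑ i : Fin n, if O i.succ 1 = true then 1 else 0) ≤ ∑ i, (c i : ℕ) := by
      rw [← sum_add_distrib]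
      refine sum_le_sum fun i _ => ?_
      have := hO i
      rw [card_filter, Fin.sum_univ_two] at this
      cases h0 : O i.succ 0 <;> cases h1 : O i.succ 1 <;> simp [h0, h1] at this ⊢ <;> omega
    have hs0 : (if O 0 0 = true then 1 else 0) ≤ 1 := by split_ifs <;> simp
    have hs1 : (if O 0 1 = true then 1 else 0) ≤ 1 := by split_ifs <;> simp
    omega
  · intro h
    have hS : #{i | c i = 1} = ∑ i, (c i : ℕ) := by
      rw [card_filter]
      refine sum_congr rfl fun i _ => ?_
      generalize c i = d
      revert d
      decide
    obtain ⟨A, hA, hAc⟩ := exists_subset_card_eq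
      (show n - (x : ℕ) ≤ #{i | c i = 1} by omega)
    have hB : #(({i | c i = 1} : Finset (Fin n)) \ A) = ∑ i, (c i : ℕ) - (n - x) := by
      rw [card_sdiff_of_subset hA, hS, hAc]
    refine ⟨Fin.cons (fun _ => true)
      fun i => ![decide (i ∈ A), decide (i ∈ ({i | c i = 1} : Finset (Fin n)) \ A)], ?_, ?_, ?_⟩
    · intro i
      rw [card_filter, Fin.sum_univ_two]
      by_cases hi : i ∈ A
      · have : c i = 1 := by simpa using hA hi
        simp [hi, this]
      · by_cases hc : c i = 1
        · simp [hi, hc]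
        · simp [hi, hc]
    · rw [card_filter, Fin.sum_univ_succ]
      simp [hAc]
      omega
    · rw [card_filter, Fin.sum_univ_succ]
      simp only [Fin.cons_zero, Fin.cons_succ, Matrix.cons_val_one, Matrix.cons_val_fin_one,
        decide_eq_true_eq, ← card_filter, filter_univ_mem]
      simp only [hB, ↓reduceIte]
      omega

open Finset in
/-- The number of pairs of lacking numbers that complete a partial level `s` to `k`. -/
theorem card_pairs_level_eq {n k : ℕ} (hk : k ≤ n) (s : ℕ) :
    #{q : Fin (n + 1) × Fin (n + 1) | s + (n - (q.1 : ℕ)) + (n - (q.2 : ℕ)) = k} =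
      if s ≤ k then k - s + 1 else 0 := by
  split_ifs with hs
  · rw [← Nat.card_antidiagonal (k - s)]
    refine card_nbij' (fun q => (n - (q.1 : ℕ), n - (q.2 : ℕ)))
      (fun q => (⟨n - q.1, by omega⟩, ⟨n - q.2, by omega⟩)) ?_ ?_ ?_ ?_
    · intro q hq
      simp at hq ⊢
      omega
    · intro q hq
      simp at hq ⊢
      omega
    · rintro ⟨⟨a, ha⟩, ⟨b, hb⟩⟩ hq
      simp
      omega
    · rintro ⟨a, b⟩ hq
      simp at hq ⊢
      omega
  · rw [card_eq_zero, filter_eq_empty_iff]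
    intro q _
    omega

open Finset in
/-- Summing a function of the number of empty vertices over all `0`-`1` assignments. -/
theorem sum_apply_sum_one_sub (n : ℕ) (g : ℕ → ℕ) :
    ∑ c : Fin n → Fin 2, g (∑ i, (1 - (c i : ℕ))) = ∑ j ∈ range (n + 1), n.choose j * g j := by
  have h := sum_powerset_apply_card g (x := (univ : Finset (Fin n)))
  simp only [card_univ, Fintype.card_fin, smul_eq_mul, powerset_univ] at h
  rw [← h]
  refine sum_nbij' (fun c => univ.filter (c · = 0)) (fun S i => if i ∈ S then 0 else 1) ?_ ?_ ?_ ?_ ?_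
  · simp
  · simp
  · intro c _
    ext i
    have : c i = 0 ∨ c i = 1 := by omega
    rcases this with h | h <;> simp [h]
  · intro S _
    ext i
    simp
  · intro c _
    rw [card_filter]
    congr 1
    refine sum_congr rfl fun i _ => ?_
    generalize c i = d
    revert d
    decide

open Finset in
/-- The number of stable configurations on `K_{n+1,2}` of level `k ≤ n`. -/
theorem card_level_eq {n k : ℕ} (hk : k ≤ n) :
    #{p : (Fin n → Fin 2) × (Fin (n + 1) × Fin (n + 1)) |
      (∑ i, (1 - (p.1 i : ℕ))) + (n - (p.2.1 : ℕ)) + (n - (p.2.2 : ℕ)) = k} =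
      ∑ j ∈ range (k + 1), n.choose j * (k - j + 1) := by
  rw [card_filter, Fintype.sum_prod_type]
  simp_rw [← card_filter, card_pairs_level_eq hk]
  rw [sum_apply_sum_one_sub n fun s => if s ≤ k then k - s + 1 else 0]
  symm
  refine sum_subset_zero_on_sdiff (range_subset_range.2 (by omega)) ?_ ?_
  · intro j hj
    have : ¬ j ≤ k := by simp at hj; omega
    simp [this]
  · intro j hj
    have : j ≤ k := by simp at hj; omega
    simp [this]

theorem sto_Km2_level_count (m : ℕ) (hm : 1 ≤ m) :
    (∀ k : ℕ, k < m →
      ((Finset.univ : Finset ((Fin (m - 1) → Fin 2) × (Fin m × Fin m))).filter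
        (fun p => (∃ O : Fin m → Fin 2 → Bool,
          (∀ i : Fin (m - 1),
            2 - (p.1 i : ℕ) ≤
              (Finset.univ.filter fun j : Fin 2 => O (leftIdx i) j = false).card) ∧
          m - (p.2.1 : ℕ) ≤ (Finset.univ.filter fun i : Fin m => O i 0 = true).card ∧
          m - (p.2.2 : ℕ) ≤ (Finset.univ.filter fun i : Fin m => O i 1 = true).card) ∧
          (∑ i : Fin (m - 1), (1 - (p.1 i : ℕ))) +
            (m - 1 - (p.2.1 : ℕ)) + (m - 1 - (p.2.2 : ℕ)) = k)).card
        = ∑ j ∈ Finset.range (k + 1), (m - 1).choose j * (k - j + 1)) ∧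
    (∀ p : (Fin (m - 1) → Fin 2) × (Fin m × Fin m),
      (∃ O : Fin m → Fin 2 → Bool,
          (∀ i : Fin (m - 1),
            2 - (p.1 i : ℕ) ≤
              (Finset.univ.filter fun j : Fin 2 => O (leftIdx i) j = false).card) ∧
          m - (p.2.1 : ℕ) ≤ (Finset.univ.filter fun i : Fin m => O i 0 = true).card ∧
          m - (p.2.2 : ℕ) ≤ (Finset.univ.filter fun i : Fin m => O i 1 = true).card) →
      (∑ i : Fin (m - 1), (1 - (p.1 i : ℕ))) +
        (m - 1 - (p.2.1 : ℕ)) + (m - 1 - (p.2.2 : ℕ)) < m) := by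
  obtain ⟨n, rfl⟩ := Nat.exists_eq_add_of_le' hm
  refine ⟨fun k hk => ?_, fun p hp => (exists_orientation_iff_level_le n p.1 p.2.1 p.2.2).1 hp⟩
  refine Eq.trans ?_ (card_level_eq (Nat.le_of_lt_succ hk))
  congr 1
  refine Finset.filter_congr fun p _ => ?_
  refine ⟨fun h => h.2, fun h => ⟨?_, h⟩⟩
  exact (exists_orientation_iff_level_le n p.1 p.2.1 p.2.2).2 (h ▸ hk)
end

section
/- For n ≥ 1, the sequence of coefficients of the lacking polynomial L_{2,n}(x), namely T(n,k) = Σ_{i=0}^{k} C(n,i) for k = 0, 1, ..., n−1, is log-concave: T(n,k)^2 ≥ T(n,k−1)·T(n,k+1) for all 0 < k < n−1. -/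
/-!
STATEMENT 10. For `n ≥ 1`, the sequence `T(n,k) = ∑_{i=0}^{k} C(n,i)`,
`k = 0, ..., n-1`, of coefficients of the lacking polynomial `L_{2,n}(x)` is
log-concave: `T(n,k-1)·T(n,k+1) ≤ T(n,k)^2` for all `0 < k < n-1`.
-/

theorem Nat.choose_mul_choose_succ_le (n : ℕ) {i k : ℕ} (h : i ≤ k) :
    n.choose i * n.choose (k + 1) ≤ n.choose (i + 1) * n.choose k := by
  refine Nat.le_of_mul_le_mul_right (c := (i + 1) * (k + 1)) ?_ (by positivity)
  calc n.choose i * n.choose (k + 1) * ((i + 1) * (k + 1))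
      = n.choose i * (n.choose (k + 1) * (k + 1)) * (i + 1) := by ring
    _ = n.choose i * n.choose k * ((n - k) * (i + 1)) := by
      rw [Nat.choose_succ_right_eq]; ring
    _ ≤ n.choose i * n.choose k * ((n - i) * (k + 1)) := by gcongr
    _ = n.choose i * (n - i) * n.choose k * (k + 1) := by ring
    _ = n.choose (i + 1) * n.choose k * ((i + 1) * (k + 1)) := by
      rw [← Nat.choose_succ_right_eq]; ring

theorem Nat.sum_range_choose_mul_choose_succ_le (n k : ℕ) :
    (∑ i ∈ Finset.range k, n.choose i) * n.choose (k + 1) ≤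
      (∑ i ∈ Finset.range (k + 1), n.choose i) * n.choose k := by
  rw [Finset.sum_range_succ', add_mul, Finset.sum_mul, Finset.sum_mul]
  exact Nat.le_add_right_of_le <| Finset.sum_le_sum fun i hi =>
    Nat.choose_mul_choose_succ_le n (Finset.mem_range.mp hi).le

theorem lacking_coeffs_K2n_log_concave (n : ℕ) (hn : 1 ≤ n) :
    ∀ k, 0 < k → k < n - 1 →
      (∑ i ∈ Finset.range k, n.choose i) * (∑ i ∈ Finset.range (k + 2), n.choose i)
        ≤ (∑ i ∈ Finset.range (k + 1), n.choose i) ^ 2 := by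
  intro k _ _
  have h := Nat.sum_range_choose_mul_choose_succ_le n k
  rw [Finset.sum_range_succ _ (k + 1)]
  rw [Finset.sum_range_succ] at h ⊢
  nlinarith
end

section
/- For m ≥ 1, the sequence of coefficients of the lacking polynomial L_{m,2}(x), namely S(m−1,k) = Σ_{q=0}^{k} Σ_{r=0}^{q} C(m−1,r) for k = 0, 1, ..., m−1, is log-concave: S(m−1,k)^2 ≥ S(m−1,k−1)·S(m−1,k+1) for all 0 < k < m−1. -/
/-!
STATEMENT 11. For `m ≥ 1`, the sequence
`S(m-1,k) = ∑_{q=0}^{k} ∑_{r=0}^{q} C(m-1,r)`, `k = 0, ..., m-1`, of coefficients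
of the lacking polynomial `L_{m,2}(x)` is log-concave:
`S(m-1,k-1)·S(m-1,k+1) ≤ S(m-1,k)^2` for all `0 < k < m-1`.
-/

/-- A sequence of natural numbers satisfying the two-index form of log-concavity, which also excludes
internal zeros. -/
def StrongLogConcave (a : ℕ → ℕ) : Prop :=
  ∀ i j, i ≤ j → a i * a (j + 1) ≤ a (i + 1) * a j

theorem StrongLogConcave.mul_le_mul_add {a : ℕ → ℕ} (ha : StrongLogConcave a) (s d e : ℕ) :
    a s * a (s + d + e) ≤ a (s + d) * a (s + e) := by
  induction d generalizing s e with
  | zero => simp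
  | succ d ih =>
    cases e with
    | zero => simp [mul_comm]
    | succ e =>
      calc a s * a (s + (d + 1) + (e + 1)) ≤ a (s + 1) * a (s + (d + 1) + e) :=
            ha s (s + (d + 1) + e) (by omega)
        _ = a (s + 1) * a (s + 1 + d + e) := by
            rw [show s + (d + 1) + e = s + 1 + d + e by omega]
        _ ≤ a (s + 1 + d) * a (s + 1 + e) := ih (s + 1) e
        _ = a (s + (d + 1)) * a (s + (e + 1)) := by
            rw [show s + 1 + d = s + (d + 1) by omega, show s + 1 + e = s + (e + 1) by omega]

theorem StrongLogConcave.sum_range_mul_le {a : ℕ → ℕ} (ha : StrongLogConcave a) {i j : ℕ}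
    (hij : i ≤ j) :
    (∑ s ∈ Finset.range i, a s) * a j ≤ a i * ∑ t ∈ Finset.range j, a t := by
  obtain ⟨d, rfl⟩ := Nat.exists_eq_add_of_le' hij
  rw [Finset.sum_range_add, mul_add, Finset.sum_mul, Finset.mul_sum (Finset.range i)]
  refine le_add_left (Finset.sum_le_sum fun s hs => ?_)
  have hs := Finset.mem_range.mp hs
  have h := ha.mul_le_mul_add s (i - s) d
  rwa [show s + (i - s) = i by omega, add_comm i d, add_comm s d] at h

theorem StrongLogConcave.sum_range {a : ℕ → ℕ} (ha : StrongLogConcave a) :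
    StrongLogConcave fun n => ∑ s ∈ Finset.range n, a s := by
  intro i j hij
  have h := ha.sum_range_mul_le hij
  simp only [Finset.sum_range_succ, mul_add, add_mul]
  omega

theorem StrongLogConcave.comp_add_one {a : ℕ → ℕ} (ha : StrongLogConcave a) :
    StrongLogConcave fun n => a (n + 1) :=
  fun i j hij => ha (i + 1) (j + 1) (by omega)

theorem strongLogConcave_choose (n : ℕ) : StrongLogConcave n.choose := by
  intro i j hij
  refine Nat.le_of_mul_le_mul_right (c := (i + 1) * (j + 1)) ?_ (by positivity)
  calc n.choose i * n.choose (j + 1) * ((i + 1) * (j + 1))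
      = n.choose i * (n.choose (j + 1) * (j + 1)) * (i + 1) := by ring
    _ = n.choose i * n.choose j * ((n - j) * (i + 1)) := by
        rw [Nat.choose_succ_right_eq]; ring
    _ ≤ n.choose i * n.choose j * ((n - i) * (j + 1)) := by gcongr
    _ = n.choose i * (n - i) * n.choose j * (j + 1) := by ring
    _ = n.choose (i + 1) * n.choose j * ((i + 1) * (j + 1)) := by
        rw [← Nat.choose_succ_right_eq]; ring

theorem lacking_coeffs_Km2_log_concave (m : ℕ) (hm : 1 ≤ m) :
    ∀ k, 0 < k → k < m - 1 →
      (∑ q ∈ Finset.range k, ∑ r ∈ Finset.range (q + 1), (m - 1).choose r) *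
          (∑ q ∈ Finset.range (k + 2), ∑ r ∈ Finset.range (q + 1), (m - 1).choose r)
        ≤ (∑ q ∈ Finset.range (k + 1), ∑ r ∈ Finset.range (q + 1), (m - 1).choose r) ^ 2 := by
  intro k _ _
  rw [sq]
  exact (strongLogConcave_choose (m - 1)).sum_range.comp_add_one.sum_range k (k + 1) (by omega)
end
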